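/- For all integers N ≥ d ≥ 1, any two non-orthodecomposable frames F, G ∈ 𝓕_{N,d}^ℂ are joined by a continuous path inside 𝓕_{N,d}^ℂ all of whose points are non-orthodecomposable; that is, the NOD frames in 𝓕_{N,d}^ℂ form a path-connected set. -/

import Mathlib

noncomputable section

/-- The set of finite unit norm tight frames (FUNTFs) of `N` vectors in `𝕜^d`,
viewed as `d × N` matrices `F` with unit-norm columns and `F * Fᴴ = (N/d) • 1`. -/
def FUNTF (𝕜 : Type*) [RCLike 𝕜] (N d : ℕ) : Set (Matrix (Fin d) (Fin N) 𝕜) :=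
  {F | F * F.conjTranspose = ((N : 𝕜) / (d : 𝕜)) • 1 ∧
       ∀ n, (F.conjTranspose * F) n n = 1}

/-- The `j`-th column of a matrix, as a vector in Euclidean space. -/
def col {𝕜 : Type*} [RCLike 𝕜] {m n : ℕ} (F : Matrix (Fin m) (Fin n) 𝕜) (j : Fin n) :
    EuclideanSpace 𝕜 (Fin m) :=
  (WithLp.equiv 2 (Fin m → 𝕜)).symm fun i => F i j
/-- A family of vectors is orthodecomposable (OD) if the index set admits a partition into
two nonempty sets `S`, `T` such that the span of the vectors indexed by `S` is the orthogonal
complement of the span of the vectors indexed by `T`. -/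
def Orthodecomposable (𝕜 : Type*) [RCLike 𝕜] {E : Type*} [NormedAddCommGroup E]
    [InnerProductSpace 𝕜 E] {ι : Type*} (f : ι → E) : Prop :=
  ∃ S T : Set ι, S.Nonempty ∧ T.Nonempty ∧ Disjoint S T ∧ S ∪ T = Set.univ ∧
    Submodule.span 𝕜 (f '' S) = (Submodule.span 𝕜 (f '' T))ᗮ

section NODAux

open scoped ComplexOrder

/-- The inverse square root of a matrix (via functional calculus). -/
def invSqrt {d : ℕ} (M : Matrix (Fin d) (Fin d) ℂ) : Matrix (Fin d) (Fin d) ℂ :=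
  cfc (fun x : ℝ => (Real.sqrt x)⁻¹) M

lemma spectrum_pos_of_posDef {d : ℕ} {M : Matrix (Fin d) (Fin d) ℂ} (hM : M.PosDef)
    {x : ℝ} (hx : x ∈ spectrum ℝ M) : 0 < x := by
  rw [hM.isHermitian.spectrum_real_eq_range_eigenvalues] at hx
  obtain ⟨i, rfl⟩ := hx
  exact hM.eigenvalues_pos i

lemma continuousOn_invSqrt_fun : ContinuousOn (fun x : ℝ => (Real.sqrt x)⁻¹) (Set.Ioi 0) :=
  Real.continuous_sqrt.continuousOn.inv₀ (fun _ hx => (Real.sqrt_pos.2 hx).ne')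

open scoped Matrix.Norms.L2Operator in
lemma invSqrt_continuousOn_aux (d : ℕ) :
    ContinuousOn (fun M : Matrix (Fin d) (Fin d) ℂ => cfc (fun x : ℝ => (Real.sqrt x)⁻¹) M)
      {M | M.PosDef} := by
  refine ContinuousOn.cfc_of_mem_nhdsSet (s := Set.Ioi (0:ℝ)) (p := IsSelfAdjoint) _ ?_
    continuousOn_id ?_ continuousOn_invSqrt_fun
  · rw [isOpen_Ioi.mem_nhdsSet]
    intro x hx
    simp only [Set.mem_iUnion] at hx
    obtain ⟨M, hM, hx⟩ := hx
    exact spectrum_pos_of_posDef hM hx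
  · intro M hM
    exact hM.isHermitian

lemma invSqrt_continuousOn (d : ℕ) :
    ContinuousOn (invSqrt (d := d)) {M | M.PosDef} := invSqrt_continuousOn_aux d

lemma invSqrt_herm {d : ℕ} (M : Matrix (Fin d) (Fin d) ℂ) :
    (invSqrt M).conjTranspose = invSqrt M := by
  have : IsSelfAdjoint (invSqrt M) := cfc_predicate _ _
  exact this

lemma invSqrt_mul {d : ℕ} {M : Matrix (Fin d) (Fin d) ℂ} (hM : M.PosDef) :
    invSqrt M * M * invSqrt M = 1 := by
  have hsa : IsSelfAdjoint M := hM.isHermitian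
  have hc : ContinuousOn (fun x : ℝ => (Real.sqrt x)⁻¹) (spectrum ℝ M) :=
    continuousOn_invSqrt_fun.mono (fun x hx => spectrum_pos_of_posDef hM hx)
  have h1 : M = cfc (fun x : ℝ => x) M := (cfc_id' ℝ M).symm
  calc invSqrt M * M * invSqrt M
      = invSqrt M * cfc (fun x : ℝ => x) M * invSqrt M := by rw [← h1]
    _ = cfc (fun x : ℝ => (Real.sqrt x)⁻¹ * x * (Real.sqrt x)⁻¹) M := by
        unfold invSqrt
        rw [← cfc_mul (fun x : ℝ => (Real.sqrt x)⁻¹) (fun x => x) M hc continuousOn_id,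
          ← cfc_mul (fun x : ℝ => (Real.sqrt x)⁻¹ * x) (fun x : ℝ => (Real.sqrt x)⁻¹) M
            (hc.mul continuousOn_id) hc]
    _ = cfc (1 : ℝ → ℝ) M := by
        apply cfc_congr
        intro x hx
        have hx := spectrum_pos_of_posDef hM hx
        have h2 := Real.sq_sqrt hx.le
        have h3 := Real.sqrt_pos.2 hx
        simp only [Pi.one_apply]
        field_simp
        linarith
    _ = 1 := cfc_one ℝ M

lemma invSqrt_smul_one {d : ℕ} (c : ℝ) :
    invSqrt ((c : ℂ) • (1 : Matrix (Fin d) (Fin d) ℂ)) = (((Real.sqrt c)⁻¹ : ℝ) : ℂ) • 1 := by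
  have h : ∀ c : ℝ, (c : ℂ) • (1 : Matrix (Fin d) (Fin d) ℂ) = algebraMap ℝ _ c := by
    intro c
    ext i j
    simp [Matrix.algebraMap_matrix_apply, Matrix.one_apply]
  rw [h, h, invSqrt, cfc_algebraMap]

/-- weighted frame operator -/
def MM {N d : ℕ} (F : Matrix (Fin d) (Fin N) ℂ) (x : Fin N → ℝ) : Matrix (Fin d) (Fin d) ℂ :=
  F * Matrix.diagonal (fun n => (x n : ℂ)) * F.conjTranspose

lemma MM_apply {N d : ℕ} (F : Matrix (Fin d) (Fin N) ℂ) (x : Fin N → ℝ) (i j : Fin d) :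
    MM F x i j = ∑ n, F i n * (x n : ℂ) * star (F j n) := by
  rw [MM, Matrix.mul_apply]
  simp only [Matrix.mul_diagonal, Matrix.conjTranspose_apply]

lemma det_mul_rect {N d : ℕ} (A : Matrix (Fin d) (Fin N) ℂ) (B : Matrix (Fin N) (Fin d) ℂ) :
    (A * B).det = ∑ p : Fin d → Fin N, (A.submatrix id p).det * ∏ i, B (p i) i := by
  simp only [Matrix.det_apply', Matrix.mul_apply, Finset.prod_univ_sum, Finset.mul_sum,
    Fintype.piFinset_univ, Finset.sum_mul]
  rw [Finset.sum_comm]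
  refine Finset.sum_congr rfl fun p _ => Finset.sum_congr rfl fun σ _ => ?_
  simp [Finset.prod_mul_distrib, mul_assoc]

lemma factorial_mul_det_mul_rect {N d : ℕ} (A : Matrix (Fin d) (Fin N) ℂ)
    (B : Matrix (Fin N) (Fin d) ℂ) :
    (d.factorial : ℂ) * (A * B).det =
      ∑ p : Fin d → Fin N, (A.submatrix id p).det * (B.submatrix p id).det := by
  have h : ∀ σ : Equiv.Perm (Fin d), (A * B).det =
      ∑ p : Fin d → Fin N, (A.submatrix id p).det *
        (((Equiv.Perm.sign σ : ℤ) : ℂ) * ∏ i, B (p (σ i)) i) := by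
    intro σ
    rw [det_mul_rect, ← (Equiv.arrowCongr σ.symm (Equiv.refl (Fin N))).sum_comp]
    refine Finset.sum_congr rfl fun p _ => ?_
    have h1 : (A.submatrix id ((Equiv.arrowCongr σ.symm (Equiv.refl (Fin N))) p)) =
        (A.submatrix id p).submatrix id σ := by
      ext i j; simp [Equiv.arrowCongr]
    rw [h1, Matrix.det_permute']
    simp [Equiv.arrowCongr]
    ring
  have h2 : ∑ σ : Equiv.Perm (Fin d), (A * B).det = (d.factorial : ℂ) * (A * B).det := by
    simp [Fintype.card_perm]
  rw [← h2, Finset.sum_congr rfl (fun σ _ => h σ), Finset.sum_comm]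
  refine Finset.sum_congr rfl fun p _ => ?_
  rw [← Finset.mul_sum, Matrix.det_apply' (B.submatrix p id)]
  simp only [Matrix.submatrix_apply, id]

/-- squared minors -/
def cp {N d : ℕ} (F : Matrix (Fin d) (Fin N) ℂ) (p : Fin d → Fin N) : ℝ :=
  Complex.normSq (F.submatrix id p).det

lemma cp_nonneg {N d : ℕ} (F : Matrix (Fin d) (Fin N) ℂ) (p : Fin d → Fin N) : 0 ≤ cp F p :=
  Complex.normSq_nonneg _

lemma det_MM {N d : ℕ} (F : Matrix (Fin d) (Fin N) ℂ) (x : Fin N → ℝ) :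
    (d.factorial : ℂ) * (MM F x).det = ((∑ p : Fin d → Fin N, cp F p * ∏ i, x (p i) : ℝ) : ℂ) := by
  rw [MM, Matrix.mul_assoc, factorial_mul_det_mul_rect]
  push_cast
  refine Finset.sum_congr rfl fun p _ => ?_
  have h1 : (Matrix.diagonal (fun n => (x n : ℂ)) * F.conjTranspose).submatrix p id =
      Matrix.of fun i j => (x (p i) : ℂ) * (F.submatrix id p).conjTranspose i j := by
    ext i j
    simp [Matrix.diagonal_mul]
  rw [h1, Matrix.det_mul_column, Matrix.det_conjTranspose, cp, ← Complex.mul_conj]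
  simp only [RCLike.star_def]
  ring

lemma MM_herm_posSemidef {N d : ℕ} (F : Matrix (Fin d) (Fin N) ℂ) (x : Fin N → ℝ)
    (hx : ∀ n, 0 ≤ x n) : (MM F x).PosSemidef := by
  apply Matrix.PosSemidef.mul_mul_conjTranspose_same
  apply Matrix.PosSemidef.diagonal
  intro n
  simpa using hx n

lemma MM_posDef {N d : ℕ} (F : Matrix (Fin d) (Fin N) ℂ) (x : Fin N → ℝ)
    (hx : ∀ n, 0 < x n) (hF : ∃ p, 0 < cp F p) : (MM F x).PosDef := by
  rw [(MM_herm_posSemidef F x (fun n => (hx n).le)).posDef_iff_det_ne_zero]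
  intro h0
  have h := det_MM F x
  rw [h0, mul_zero] at h
  have h : ∑ p : Fin d → Fin N, cp F p * ∏ i, x (p i) = 0 := by exact_mod_cast h.symm
  obtain ⟨p, hp⟩ := hF
  rw [Finset.sum_eq_zero_iff_of_nonneg] at h
  · have := h p (Finset.mem_univ _)
    have h2 : 0 < ∏ i, x (p i) := Finset.prod_pos fun i _ => hx _
    nlinarith [mul_pos hp h2]
  · intro p _
    exact mul_nonneg (cp_nonneg F p) (Finset.prod_nonneg fun i _ => (hx _).le)

/-- leverage score -/
def lev {N d : ℕ} (F : Matrix (Fin d) (Fin N) ℂ) (x : Fin N → ℝ) (n : Fin N) : ℂ :=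
  (F.conjTranspose * (MM F x)⁻¹ * F) n n

lemma det_MM_update {N d : ℕ} (F : Matrix (Fin d) (Fin N) ℂ) (x : Fin N → ℝ)
    (hx : IsUnit (MM F x).det) (n : Fin N) (δ : ℝ) :
    (MM F (x + Pi.single n δ)).det = (MM F x).det * (1 + δ * lev F x n) := by
  have h1 : MM F (x + Pi.single n δ) = MM F x +
      Matrix.replicateCol Unit (fun i => (δ : ℂ) * F i n) *
        Matrix.replicateRow Unit (fun i => star (F i n)) := by
    ext i j
    rw [Matrix.add_apply, MM_apply, MM_apply, Matrix.mul_apply]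
    simp only [Matrix.replicateCol_apply, Matrix.replicateRow_apply, Finset.univ_unique,
      Finset.sum_singleton, Pi.add_apply, Complex.ofReal_add]
    simp only [mul_add, add_mul, Finset.sum_add_distrib]
    congr 1
    rw [Finset.sum_eq_single n]
    · rw [Pi.single_eq_same]; ring
    · intro b _ hb; simp [Pi.single_eq_of_ne hb]
    · simp
  rw [h1, Matrix.det_add_replicateCol_mul_replicateRow hx]
  congr 1
  have h2 : (1 + Matrix.replicateRow Unit (fun i => star (F i n)) * (MM F x)⁻¹ *
      Matrix.replicateCol Unit (fun i => (δ : ℂ) * F i n)).det = _ := Matrix.det_unique _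
  rw [h2]
  simp only [lev, Matrix.add_apply, Matrix.mul_apply, Matrix.replicateCol_apply,
    Matrix.replicateRow_apply, Matrix.conjTranspose_apply, Matrix.one_apply_eq, Finset.mul_sum]
  congr 1
  refine Finset.sum_congr rfl fun i _ => ?_
  ring

/-- Continuity of the unique minimizer of a convex function depending on a parameter. -/
lemma continuous_minimizer {X E : Type*} [TopologicalSpace X] [NormedAddCommGroup E]
    [NormedSpace ℝ E] [FiniteDimensional ℝ E] (H : Set E) (hHc : IsClosed H)
    (f : X → E → ℝ) (hf : Continuous (fun q : X × E => f q.1 q.2))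
    (hconv : ∀ x, ConvexOn ℝ H (f x)) (τ : X → E) (hτ : ∀ x, τ x ∈ H)
    (hmin : ∀ x, ∀ t ∈ H, t ≠ τ x → f x (τ x) < f x t) : Continuous τ := by
  have : ProperSpace E := FiniteDimensional.proper ℝ E
  rw [continuous_iff_continuousAt]
  intro x₀
  rw [ContinuousAt, Metric.tendsto_nhds]
  intro ε hε
  have hK : IsCompact (Metric.sphere (τ x₀) ε ∩ H) := (isCompact_sphere _ _).inter_right hHc
  have hev : ∀ᶠ x in nhds x₀, ∀ u ∈ Metric.sphere (τ x₀) ε ∩ H, f x (τ x₀) < f x u := by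
    apply hK.eventually_forall_of_forall_eventually
    rintro u ⟨hu, huH⟩
    have hne : u ≠ τ x₀ := by
      rintro rfl
      simp at hu
      exact hε.ne hu
    have hlt := hmin x₀ u huH hne
    have h1 : Continuous (fun q : X × E => f q.1 (τ x₀)) :=
      hf.comp (continuous_fst.prodMk continuous_const)
    exact h1.continuousAt.eventually_lt hf.continuousAt hlt
  filter_upwards [hev] with x hx
  by_contra hcon
  push Not at hcon
  set r := dist (τ x) (τ x₀) with hr
  have hr0 : 0 < r := hε.trans_le hcon
  have hs0 : 0 ≤ ε / r := by positivity
  have hs1 : ε / r ≤ 1 := (div_le_one hr0).2 hcon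
  set u := (1 - ε / r) • τ x₀ + (ε / r) • τ x with hu
  have huH : u ∈ H := (hconv x).1 (hτ x₀) (hτ x) (by linarith) hs0 (by ring)
  have hus : u ∈ Metric.sphere (τ x₀) ε := by
    rw [Metric.mem_sphere, dist_eq_norm]
    have : u - τ x₀ = (ε / r) • (τ x - τ x₀) := by rw [hu]; module
    rw [this, norm_smul, ← dist_eq_norm, ← hr, Real.norm_of_nonneg hs0]
    field_simp
  have h1 := hx u ⟨hus, huH⟩
  have h2 : f x u ≤ (1 - ε / r) * f x (τ x₀) + (ε / r) * f x (τ x) :=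
    (hconv x).2 (hτ x₀) (hτ x) (by linarith) hs0 (by ring)
  have h3 : f x (τ x) ≤ f x (τ x₀) := by
    by_cases h : τ x₀ = τ x
    · rw [h]
    · exact (hmin x _ (hτ x₀) h).le
  nlinarith

section expsum
variable {E ι : Type*} [NormedAddCommGroup E] [NormedSpace ℝ E] [FiniteDimensional ℝ E]
  [Fintype ι] (H : Submodule ℝ E) (c : ι → ℝ) (L : ι → E →ₗ[ℝ] ℝ)

lemma expsum_strictConvex (hc : ∀ i, 0 ≤ c i)
    (hsep : ∀ u ∈ H, u ≠ 0 → ∃ i, 0 < c i ∧ 0 < L i u) :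
    StrictConvexOn ℝ (H : Set E) (fun t => ∑ i, c i * Real.exp (L i t)) := by
  refine ⟨H.convex, ?_⟩
  intro x hx y hy hxy a b ha hb hab
  simp only [smul_eq_mul, Finset.mul_sum]
  rw [← Finset.sum_add_distrib]
  have key : ∀ i, L i (a • x + b • y) = a * L i x + b * L i y := by intro i; simp
  obtain ⟨j, hj, hjL⟩ := hsep (x - y) (H.sub_mem hx hy) (sub_ne_zero.2 hxy)
  apply Finset.sum_lt_sum
  · intro i _
    have := convexOn_exp.2 (Set.mem_univ (L i x)) (Set.mem_univ (L i y)) ha.le hb.le hab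
    rw [key]
    simp only [smul_eq_mul] at this
    nlinarith [hc i, mul_le_mul_of_nonneg_left this (hc i)]
  · refine ⟨j, Finset.mem_univ _, ?_⟩
    have hne : L j x ≠ L j y := by
      rw [map_sub] at hjL
      intro h; rw [h] at hjL; simp at hjL
    have := strictConvexOn_exp.2 (Set.mem_univ (L j x)) (Set.mem_univ (L j y)) hne ha hb hab
    rw [key]
    simp only [smul_eq_mul] at this
    nlinarith [mul_lt_mul_of_pos_left this hj]

lemma expsum_exists_min (hc : ∀ i, 0 ≤ c i)
    (hsep : ∀ u ∈ H, u ≠ 0 → ∃ i, 0 < c i ∧ 0 < L i u) :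
    ∃ t₀ ∈ H, ∀ t ∈ H, ∑ i, c i * Real.exp (L i t₀) ≤ ∑ i, c i * Real.exp (L i t) := by
  have : ProperSpace E := FiniteDimensional.proper ℝ E
  have hLc : ∀ i, Continuous (L i) := fun i => LinearMap.continuous_of_finiteDimensional _
  set q : E → ℝ := fun u => ∑ i, c i * max (L i u) 0 with hq
  have hqc : Continuous q := by
    apply continuous_finsetSum
    intro i _
    exact continuous_const.mul ((hLc i).max continuous_const)
  have hqpos : ∀ u ∈ H, u ≠ 0 → 0 < q u := by
    intro u hu hu0
    obtain ⟨j, hj, hjL⟩ := hsep u hu hu0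
    apply Finset.sum_pos'
    · intro i _; exact mul_nonneg (hc i) (le_max_right _ _)
    · exact ⟨j, Finset.mem_univ _, mul_pos hj (lt_max_of_lt_left hjL)⟩
  have hHc : IsClosed (H : Set E) := H.closed_of_finiteDimensional
  have hK : IsCompact (Metric.sphere (0 : E) 1 ∩ H) := (isCompact_sphere _ _).inter_right hHc
  have hscale : ∀ u, ∀ r : ℝ, 0 ≤ r → q (r • u) = r * q u := by
    intro u r hr
    simp only [hq, Finset.mul_sum]
    refine Finset.sum_congr rfl fun i _ => ?_
    rw [map_smul, smul_eq_mul, mul_left_comm, mul_max_of_nonneg _ _ hr, mul_zero]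
  have hm : ∃ m : ℝ, 0 < m ∧ ∀ t ∈ H, m * ‖t‖ ≤ q t := by
    rcases (Metric.sphere (0 : E) 1 ∩ H).eq_empty_or_nonempty with he | hne
    · refine ⟨1, one_pos, ?_⟩
      intro t ht
      by_cases h0 : t = 0
      · subst h0; simp [hq]
      · exfalso
        have : ‖t‖⁻¹ • t ∈ Metric.sphere (0 : E) 1 ∩ H := by
          refine ⟨?_, H.smul_mem _ ht⟩
          simp [norm_smul, norm_ne_zero_iff.2 h0]
        rw [he] at this
        exact this
    · obtain ⟨u, hu, hmin⟩ := hK.exists_isMinOn hne hqc.continuousOn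
      have hu0 : u ≠ 0 := by
        rintro rfl
        simpa using hu.1
      refine ⟨q u, hqpos u hu.2 hu0, ?_⟩
      intro t ht
      by_cases h0 : t = 0
      · subst h0; simp [hq]
      · have hn : ‖t‖ ≠ 0 := norm_ne_zero_iff.2 h0
        have hmem : ‖t‖⁻¹ • t ∈ Metric.sphere (0 : E) 1 ∩ H := by
          refine ⟨?_, H.smul_mem _ ht⟩
          simp [norm_smul, hn]
        have h1 : q u ≤ q (‖t‖⁻¹ • t) := hmin hmem
        rw [hscale _ _ (by positivity)] at h1
        have h2 := mul_le_mul_of_nonneg_right h1 (norm_nonneg t)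
        have h3 : ‖t‖⁻¹ * q t * ‖t‖ = q t := by field_simp
        linarith
  obtain ⟨m, hm0, hm⟩ := hm
  set f : E → ℝ := fun t => ∑ i, c i * Real.exp (L i t) with hf
  have hfc : Continuous f := by
    apply continuous_finsetSum
    intro i _
    exact continuous_const.mul (Real.continuous_exp.comp (hLc i))
  have hfq : ∀ t, q t ≤ f t := by
    intro t
    apply Finset.sum_le_sum
    intro i _
    apply mul_le_mul_of_nonneg_left _ (hc i)
    apply max_le
    · linarith [Real.add_one_le_exp (L i t)]
    · exact (Real.exp_pos _).le
  obtain ⟨t₀, ht₀, hmin⟩ := hfc.continuousOn.exists_isMinOn' hHc H.zero_mem (by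
    have h1 := (tendsto_norm_cocompact_atTop (E := E)).eventually_ge_atTop (f 0 / m)
    rw [Filter.eventually_inf_principal]
    filter_upwards [h1] with t ht htH
    have h2 := hm t htH
    have h3 := hfq t
    rw [div_le_iff₀ hm0] at ht
    nlinarith)
  exact ⟨t₀, ht₀, fun t ht => hmin ht⟩

end expsum

lemma layer_cake_one (a b y : ℝ) (hab : a ≤ b) (hay : a ≤ y) (hyb : y ≤ b) :
    ∫ c in a..b, (Set.Iic y).indicator (fun _ => (1 : ℝ)) c = y - a := by
  rw [intervalIntegral.integral_of_le hab, MeasureTheory.setIntegral_indicator measurableSet_Iic,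
    Set.Ioc_inter_Iic, min_eq_right hyb]
  simp [hay]

lemma layer_cake_pos {N : ℕ} (w u : Fin N → ℝ) (hw : ∑ n, w n = 0)
    (hu : ∃ n m, u n ≠ u m)
    (hpos : ∀ c : ℝ, (Finset.univ.filter (fun n => c ≤ u n)).Nonempty →
      Finset.univ.filter (fun n => c ≤ u n) ≠ Finset.univ →
      0 < ∑ n ∈ Finset.univ.filter (fun n => c ≤ u n), w n) :
    0 < ∑ n, w n * u n := by
  obtain ⟨n₁, m₁, hne⟩ := hu
  have hN : (Finset.univ : Finset (Fin N)).Nonempty := ⟨n₁, Finset.mem_univ _⟩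
  obtain ⟨na, -, ha⟩ := Finset.exists_min_image Finset.univ u hN
  obtain ⟨nb, -, hb⟩ := Finset.exists_max_image Finset.univ u hN
  replace ha : ∀ n, u na ≤ u n := fun n => ha n (Finset.mem_univ _)
  replace hb : ∀ n, u n ≤ u nb := fun n => hb n (Finset.mem_univ _)
  have hab : u na < u nb := by
    rcases lt_or_gt_of_ne hne with h | h
    · linarith [ha n₁, hb m₁]
    · linarith [ha m₁, hb n₁]
  have hIntg : ∀ n, IntervalIntegrable ((Set.Iic (u n)).indicator (fun _ => (1 : ℝ)))
      MeasureTheory.volume (u na) (u nb) := by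
    intro n
    rw [intervalIntegrable_iff]
    apply MeasureTheory.IntegrableOn.indicator _ measurableSet_Iic
    rw [← intervalIntegrable_iff]
    exact intervalIntegrable_const
  have h1 : ∑ n, w n * u n = ∫ c in (u na)..(u nb),
      ∑ n, w n * (Set.Iic (u n)).indicator (fun _ => (1 : ℝ)) c := by
    rw [intervalIntegral.integral_finsetSum (fun n _ => (hIntg n).const_mul _)]
    simp only [intervalIntegral.integral_const_mul]
    have : ∀ n, w n * u n = w n * (u n - u na) + w n * u na := fun n => by ring
    simp_rw [this]
    rw [Finset.sum_add_distrib, ← Finset.sum_mul, hw, zero_mul, add_zero]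
    refine Finset.sum_congr rfl fun n _ => ?_
    rw [layer_cake_one _ _ _ hab.le (ha n) (hb n)]
  rw [h1]
  apply intervalIntegral.intervalIntegral_pos_of_pos_on _ _ hab
  · have := IntervalIntegrable.sum Finset.univ
      (f := fun n c => w n * (Set.Iic (u n)).indicator (fun _ => (1 : ℝ)) c)
      (fun n _ => (hIntg n).const_mul (w n))
    have e : (fun c => ∑ n, w n * (Set.Iic (u n)).indicator (fun _ => (1 : ℝ)) c) =
        ∑ n, fun c => w n * (Set.Iic (u n)).indicator (fun _ => (1 : ℝ)) c := by
      ext c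
      rw [Finset.sum_apply]
    rw [e]
    exact this
  · intro c hc
    have h2 : ∑ n, w n * (Set.Iic (u n)).indicator (fun _ => (1 : ℝ)) c =
        ∑ n ∈ Finset.univ.filter (fun n => c ≤ u n), w n := by
      rw [Finset.sum_filter]
      refine Finset.sum_congr rfl fun n _ => ?_
      by_cases h : c ≤ u n <;> simp [h]
    rw [h2]
    apply hpos
    · exact ⟨nb, by simpa using hc.2.le⟩
    · intro h
      have : na ∈ Finset.univ.filter (fun n => c ≤ u n) := by rw [h]; simp
      simp at this
      linarith [hc.1]

/-- The rank of the subfamily of columns indexed by `S`. -/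
def rk {N d : ℕ} (F : Matrix (Fin d) (Fin N) ℂ) (S : Finset (Fin N)) : ℕ :=
  Module.finrank ℂ (Submodule.span ℂ (col F '' (S : Set (Fin N))))

/-- Stability in the sense of geometric invariant theory. -/
def Stable {N d : ℕ} (F : Matrix (Fin d) (Fin N) ℂ) : Prop :=
  d ≤ rk F Finset.univ ∧
    ∀ S : Finset (Fin N), S.Nonempty → S ≠ Finset.univ → d * S.card < N * rk F S

/-- exponents -/
def LL {N d : ℕ} (p : Fin d → Fin N) : (Fin N → ℝ) →ₗ[ℝ] ℝ :=
  ∑ i, LinearMap.proj (p i) - ((d : ℝ) / N) • ∑ n, LinearMap.proj n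

lemma LL_apply {N d : ℕ} (p : Fin d → Fin N) (t : Fin N → ℝ) :
    LL p t = ∑ i, t (p i) - ((d : ℝ) / N) * ∑ n, t n := by
  simp [LL]

/-- The hyperplane of vectors with zero sum. -/
def HH (N : ℕ) : Submodule ℝ (Fin N → ℝ) := LinearMap.ker (∑ n, LinearMap.proj n)

lemma mem_HH {N : ℕ} (t : Fin N → ℝ) : t ∈ HH N ↔ ∑ n, t n = 0 := by
  simp [HH]

/-- Greedy bases: columns in upper level sets are spanned by basis elements in the level set. -/
lemma rk_le_of_max {N d : ℕ} (F : Matrix (Fin d) (Fin N) ℂ) (u : Fin N → ℝ) (p : Fin d → Fin N)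
    (hp : 0 < cp F p) (hmax : ∀ p', 0 < cp F p' → ∑ i, u (p' i) ≤ ∑ i, u (p i)) (c : ℝ) :
    rk F (Finset.univ.filter (fun n => c ≤ u n)) ≤
      (Finset.univ.filter (fun i => c ≤ u (p i))).card := by
  classical
  set A := F.submatrix id p with hA
  have hdet : A.det ≠ 0 := by
    intro h
    rw [cp, ← hA, h] at hp
    simp at hp
  have hcr : ∀ m i, u (p i) < u m → A.cramer (fun k => F k m) i = 0 := by
    intro m i hlt
    by_contra hne
    have h1 : F.submatrix id (Function.update p i m) = A.updateCol i (fun k => F k m) := by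
      ext k j
      by_cases hj : j = i
      · subst hj; simp
      · simp [hA, Matrix.updateCol_ne hj, Function.update_of_ne hj]
    have h2 := hmax (Function.update p i m) (by
      rw [cp, h1, ← Matrix.cramer_apply]
      exact Complex.normSq_pos.2 hne)
    have h3 : ∑ j, u (Function.update p i m j) = ∑ j, u (p j) - u (p i) + u m := by
      rw [← Finset.add_sum_erase _ _ (Finset.mem_univ i),
        ← Finset.add_sum_erase _ (fun j => u (p j)) (Finset.mem_univ i)]
      have : ∑ x ∈ Finset.univ.erase i, u (Function.update p i m x) =
          ∑ x ∈ Finset.univ.erase i, u (p x) := by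
        refine Finset.sum_congr rfl fun j hj => ?_
        rw [Function.update_of_ne (Finset.ne_of_mem_erase hj)]
      rw [this]
      simp
      ring
    linarith
  have hsub : Submodule.span ℂ (col F '' ((Finset.univ.filter (fun n => c ≤ u n) :
      Finset (Fin N)) : Set (Fin N))) ≤
      Submodule.span ℂ (((Finset.univ.filter (fun i => c ≤ u (p i))).image
        (fun i => col F (p i)) : Finset _) : Set (EuclideanSpace ℂ (Fin d))) := by
    rw [Submodule.span_le]
    rintro _ ⟨m, hm, rfl⟩
    simp only [Finset.coe_filter, Finset.mem_univ, true_and, Set.mem_ofPred_eq] at hm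
    have hexp : A.det • col F m = ∑ i, A.cramer (fun k => F k m) i • col F (p i) := by
      have h := Matrix.mulVec_cramer A (fun k => F k m)
      ext k
      have hk := congrFun h k
      simp only [Matrix.mulVec, dotProduct, Pi.smul_apply, smul_eq_mul] at hk
      have hcol : ∀ j, col F j k = F k j := fun _ => rfl
      rw [WithLp.ofLp_sum]
      simp only [PiLp.smul_apply, Finset.sum_apply, smul_eq_mul, hcol]
      rw [← hk]
      refine Finset.sum_congr rfl fun i _ => ?_
      rw [mul_comm]; rfl
    have hmem : A.det • col F m ∈ Submodule.span ℂ
        (((Finset.univ.filter (fun i => c ≤ u (p i))).image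
        (fun i => col F (p i)) : Finset _) : Set (EuclideanSpace ℂ (Fin d))) := by
      rw [hexp]
      apply Submodule.sum_mem
      intro i _
      by_cases hi : c ≤ u (p i)
      · apply Submodule.smul_mem
        apply Submodule.subset_span
        simp only [Finset.coe_image, Finset.coe_filter, Finset.mem_univ, true_and]
        exact ⟨i, hi, rfl⟩
      · push Not at hi
        rw [hcr m i (lt_of_lt_of_le hi hm), zero_smul]
        exact Submodule.zero_mem _
    exact (Submodule.smul_mem_iff _ hdet).1 hmem
  refine (Submodule.finrank_mono hsub).trans ?_
  refine (finrank_span_finset_le_card _).trans Finset.card_image_le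

lemma exists_cp_pos {N d : ℕ} {F : Matrix (Fin d) (Fin N) ℂ} (hF : d ≤ rk F Finset.univ) :
    ∃ p, 0 < cp F p := by
  obtain ⟨g, hg, -, hli⟩ := Submodule.exists_fun_fin_finrank_span_eq ℂ
    (col F '' ((Finset.univ : Finset (Fin N)) : Set (Fin N)))
  have hle : rk F Finset.univ ≤ d := by
    have := Submodule.finrank_le (Submodule.span ℂ (col F '' ((Finset.univ : Finset (Fin N)) : Set (Fin N))))
    simpa [rk] using this
  have heq : d = Module.finrank ℂ (Submodule.span ℂ (col F '' ((Finset.univ : Finset (Fin N)) : Set (Fin N)))) :=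
    le_antisymm hF hle
  choose q hq1 hq2 using hg
  refine ⟨fun i => q (Fin.cast heq i), ?_⟩
  rw [cp, Complex.normSq_pos]
  have hli2 : LinearIndependent ℂ (fun i : Fin d => col F (q (Fin.cast heq i))) := by
    have : (fun i : Fin d => col F (q (Fin.cast heq i))) = g ∘ (Fin.cast heq) := by
      ext1 i; exact hq2 _
    rw [this]
    exact hli.comp _ (Fin.cast_injective heq)
  have hli3 := hli2.map' (WithLp.linearEquiv 2 ℂ (Fin d → ℂ)).toLinearMap (LinearEquiv.ker _)
  have hli4 : LinearIndependent ℂ (F.submatrix id (fun i => q (Fin.cast heq i))).col := hli3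
  rw [Matrix.linearIndependent_cols_iff_isUnit, Matrix.isUnit_iff_isUnit_det] at hli4
  exact hli4.ne_zero

lemma stable_sep {N d : ℕ} {F : Matrix (Fin d) (Fin N) ℂ} (hF : Stable F)
    (u : Fin N → ℝ) (hu : u ∈ HH N) (hu0 : u ≠ 0) : ∃ p, 0 < cp F p ∧ 0 < LL p u := by
  classical
  rw [mem_HH] at hu
  obtain ⟨p₀, hp₀⟩ := exists_cp_pos hF.1
  obtain ⟨p, hp, hmax⟩ := Finset.exists_max_image
    (Finset.univ.filter (fun p : Fin d → Fin N => 0 < cp F p)) (fun p => ∑ i, u (p i))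
    ⟨p₀, by simpa using hp₀⟩
  simp only [Finset.mem_filter, Finset.mem_univ, true_and] at hp hmax
  refine ⟨p, hp, ?_⟩
  have hnc : ∃ n m, u n ≠ u m := by
    by_contra hcon
    push Not at hcon
    apply hu0
    ext n
    have : ∑ m, u m = N * u n := by
      rw [Finset.sum_congr rfl (fun m _ => hcon m n)]; simp
    rw [hu] at this
    have hN : (N : ℝ) ≠ 0 := by
      have := n.pos
      positivity
    simpa [hN] using this.symm
  have hN : 0 < (N : ℝ) := by
    obtain ⟨n, -⟩ := hnc
    have := n.pos
    positivity
  have hsum : ∀ S : Finset (Fin N), ∑ n ∈ S, ((N : ℝ) *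
      (Finset.univ.filter (fun i => p i = n)).card - d) =
      N * (Finset.univ.filter (fun i => p i ∈ S)).card - d * S.card := by
    intro S
    rw [Finset.sum_sub_distrib, ← Finset.mul_sum]
    have : (Finset.univ.filter (fun i => p i ∈ S)).card =
        ∑ n ∈ S, (Finset.univ.filter (fun i => p i = n)).card := by
      rw [Finset.card_eq_sum_card_fiberwise (f := p) (t := S)]
      · refine Finset.sum_congr rfl fun n hn => ?_
        congr 1
        ext i
        simp
        rintro rfl
        exact hn
      · intro i hi
        simpa using hi
    rw [this]
    simp [mul_comm]
  have hkey := layer_cake_pos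
    (fun n => (N : ℝ) * (Finset.univ.filter (fun i => p i = n)).card - d) u
    (by rw [hsum]; simp [mul_comm]) hnc (by
      intro c h1 h2
      rw [hsum]
      have h3 := hF.2 _ h1 h2
      have h4 := rk_le_of_max F u p hp hmax c
      have h5 : N * rk F (Finset.univ.filter (fun n => c ≤ u n)) ≤
        N * (Finset.univ.filter (fun i => c ≤ u (p i))).card := Nat.mul_le_mul_left _ h4
      have h6 := lt_of_lt_of_le h3 h5
      have h7 : (d : ℝ) * (Finset.univ.filter (fun n => c ≤ u n)).card <
        N * (Finset.univ.filter (fun i => c ≤ u (p i))).card := by exact_mod_cast h6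
      simpa using h7)
  have h8 : ∑ n, ((N : ℝ) * (Finset.univ.filter (fun i => p i = n)).card - d) * u n =
      N * ∑ i, u (p i) := by
    simp only [sub_mul, Finset.sum_sub_distrib, ← Finset.mul_sum, hu, mul_zero, sub_zero, mul_assoc]
    congr 1
    rw [← Finset.sum_fiberwise (s := Finset.univ) (g := p) (f := fun i => u (p i))]
    refine Finset.sum_congr rfl fun n _ => ?_
    rw [Finset.sum_congr rfl (g := fun _ => u n) (fun i hi => by simp at hi; rw [hi])]
    simp
  rw [h8] at hkey
  rw [LL_apply, hu, mul_zero, sub_zero]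
  exact (mul_pos_iff_of_pos_left hN).1 hkey

/-- The potential whose minimizer gives the scaling. -/
def Psi {N d : ℕ} (F : Matrix (Fin d) (Fin N) ℂ) (t : Fin N → ℝ) : ℝ :=
  ∑ p : Fin d → Fin N, cp F p * Real.exp (LL p t)

/-- exponential weights -/
def ex {N : ℕ} (t : Fin N → ℝ) : Fin N → ℝ := fun n => Real.exp (t n)

lemma Psi_pos {N d : ℕ} {F : Matrix (Fin d) (Fin N) ℂ} (hF : ∃ p, 0 < cp F p) (t : Fin N → ℝ) :
    0 < Psi F t := by
  obtain ⟨p, hp⟩ := hF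
  apply Finset.sum_pos'
  · intro q _; exact mul_nonneg (cp_nonneg F q) (Real.exp_pos _).le
  · exact ⟨p, Finset.mem_univ _, mul_pos hp (Real.exp_pos _)⟩

lemma det_ex {N d : ℕ} (F : Matrix (Fin d) (Fin N) ℂ) (t : Fin N → ℝ) :
    (d.factorial : ℂ) * (MM F (ex t)).det =
      ((Psi F t * Real.exp (((d : ℝ) / N) * ∑ n, t n) : ℝ) : ℂ) := by
  rw [det_MM, Psi, Finset.sum_mul]
  congr 1
  refine Finset.sum_congr rfl fun p _ => ?_
  rw [mul_assoc, ← Real.exp_add, LL_apply]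
  simp only [ex]
  rw [← Real.exp_sum]
  congr 2
  ring

lemma MM_ex_posDef {N d : ℕ} {F : Matrix (Fin d) (Fin N) ℂ} (hF : ∃ p, 0 < cp F p)
    (t : Fin N → ℝ) : (MM F (ex t)).PosDef :=
  MM_posDef F _ (fun _ => Real.exp_pos _) hF

lemma Psi_update {N d : ℕ} {F : Matrix (Fin d) (Fin N) ℂ} (hF : ∃ p, 0 < cp F p)
    (t : Fin N → ℝ) (n : Fin N) (s : ℝ) :
    ((Psi F (t + Pi.single n s) * Real.exp (((d : ℝ) / N) * s) : ℝ) : ℂ) =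
      (Psi F t : ℂ) * (1 + ((Real.exp s - 1 : ℝ) : ℂ) * ((ex t n : ℝ) * lev F (ex t) n)) := by
  have h1 : ex (t + Pi.single n s) = ex t + Pi.single n ((Real.exp s - 1) * ex t n) := by
    ext m
    by_cases h : m = n
    · subst h
      simp [ex, Real.exp_add]
      ring
    · simp [ex, Pi.single_eq_of_ne h]
  have hu : IsUnit (MM F (ex t)).det := (MM_ex_posDef hF t).det_pos.ne'.isUnit
  have h2 := det_MM_update F (ex t) hu n ((Real.exp s - 1) * ex t n)
  rw [← h1] at h2
  have h3 := det_ex F (t + Pi.single n s)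
  have h4 := det_ex F t
  rw [h2, ← mul_assoc, h4] at h3
  have h5 : ∑ m, (t + Pi.single n s : Fin N → ℝ) m = ∑ m, t m + s := by
    simp [Finset.sum_add_distrib]
  rw [h5, mul_add ((d : ℝ) / N), Real.exp_add] at h3
  have h6 : (Real.exp (((d : ℝ) / N) * ∑ n, t n) : ℂ) ≠ 0 := by
    exact_mod_cast (Real.exp_pos _).ne'
  apply mul_left_cancel₀ h6
  push_cast at h3 ⊢
  linear_combination -h3

lemma lev_of_min {N d : ℕ} (hN : 0 < N) {F : Matrix (Fin d) (Fin N) ℂ} (hF : ∃ p, 0 < cp F p)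
    (t : Fin N → ℝ) (hmin : ∀ t' ∈ HH N, Psi F t ≤ Psi F t') (n : Fin N) :
    (ex t n : ℂ) * lev F (ex t) n = ((d : ℝ) / N : ℝ) := by
  have hN' : (N : ℝ) ≠ 0 := by positivity
  have hmin' : ∀ t', Psi F t ≤ Psi F t' := by
    intro t'
    set m := (∑ n, t' n) / N with hm
    have hs : ∑ n, (t' n - m) = 0 := by
      rw [Finset.sum_sub_distrib]
      simp [hm]
      field_simp
      simp
    have h1 := hmin (fun n => t' n - m) ((mem_HH _).2 hs)
    have h2 : Psi F (fun n => t' n - m) = Psi F t' := by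
      unfold Psi
      refine Finset.sum_congr rfl fun p _ => ?_
      congr 2
      rw [LL_apply, LL_apply, hs, Finset.sum_sub_distrib]
      simp [hm]
      ring
    rwa [h2] at h1
  set l : ℂ := (ex t n : ℂ) * lev F (ex t) n with hl
  have hP := Psi_pos hF t
  have hre : ∀ s : ℝ, Psi F (t + Pi.single n s) * Real.exp (((d : ℝ) / N) * s) =
      Psi F t * (1 + (Real.exp s - 1) * l.re) := by
    intro s
    have h := congrArg Complex.re (Psi_update hF t n s)
    rw [← hl] at h
    rw [Complex.ofReal_re, Complex.re_ofReal_mul, Complex.add_re, Complex.re_ofReal_mul,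
      Complex.one_re] at h
    exact h
  have him : l.im = 0 := by
    have h := congrArg Complex.im (Psi_update hF t n 1)
    rw [← hl] at h
    rw [Complex.ofReal_im, Complex.im_ofReal_mul, Complex.add_im, Complex.im_ofReal_mul,
      Complex.one_im, zero_add] at h
    have h1 : Real.exp 1 - 1 ≠ 0 := by
      have := Real.add_one_lt_exp (x := 1) one_ne_zero
      linarith
    rcases mul_eq_zero.1 h.symm with h | h
    · exact absurd h hP.ne'
    · exact (mul_eq_zero.1 h).resolve_left h1
  have hk : ∀ s : ℝ, 0 ≤ 1 + (Real.exp s - 1) * l.re - Real.exp (((d : ℝ) / N) * s) := by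
    intro s
    have h1 := hre s
    have h2 := mul_le_mul_of_nonneg_right (hmin' (t + Pi.single n s))
      (Real.exp_pos (((d : ℝ) / N) * s)).le
    rw [h1] at h2
    have := le_of_mul_le_mul_left h2 hP
    linarith
  have hder : HasDerivAt (fun s : ℝ => 1 + (Real.exp s - 1) * l.re - Real.exp (((d : ℝ) / N) * s))
      (l.re - (d : ℝ) / N) 0 := by
    have h1 : HasDerivAt (fun s : ℝ => (Real.exp s - 1) * l.re) (Real.exp 0 * l.re) 0 :=
      ((Real.hasDerivAt_exp 0).sub_const 1).mul_const _
    have h2 : HasDerivAt (fun s : ℝ => Real.exp (((d : ℝ) / N) * s))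
      (Real.exp (((d : ℝ) / N) * 0) * (((d : ℝ) / N) * 1)) 0 :=
      ((hasDerivAt_id (0:ℝ)).const_mul ((d : ℝ) / N)).exp
    have h3 := (h1.const_add 1).sub h2
    refine h3.congr_deriv ?_
    simp
  have hloc : IsLocalMin (fun s : ℝ => 1 + (Real.exp s - 1) * l.re -
      Real.exp (((d : ℝ) / N) * s)) 0 := by
    apply Filter.Eventually.of_forall
    intro s
    simpa using hk s
  have h0 := hloc.hasDerivAt_eq_zero hder
  apply Complex.ext
  · rw [Complex.ofReal_re]; linarith
  · rw [Complex.ofReal_im]; exact him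

lemma Psi_min_of_lev {N d : ℕ} {F : Matrix (Fin d) (Fin N) ℂ} (hF : ∃ p, 0 < cp F p)
    (hlev : ∀ n, lev F (ex 0) n = ((d : ℝ) / N : ℝ)) (t : Fin N → ℝ) :
    Psi F 0 ≤ Psi F t := by
  have hsingle : ∀ n, ∑ p : Fin d → Fin N, cp F p * LL p (Pi.single n (1:ℝ)) = 0 := by
    intro n
    have h1 : ∀ s : ℝ, Psi F (Pi.single n s) =
        Psi F 0 * ((1 + (Real.exp s - 1) * ((d : ℝ) / N)) * Real.exp (-(((d : ℝ) / N) * s))) := by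
      intro s
      have h := Psi_update hF 0 n s
      rw [hlev] at h
      have h0 : ex (0 : Fin N → ℝ) n = 1 := by simp [ex]
      rw [h0, zero_add] at h
      have h2 : Psi F (Pi.single n s) * Real.exp (((d : ℝ) / N) * s) =
          Psi F 0 * (1 + (Real.exp s - 1) * (1 * ((d : ℝ) / N))) := by exact_mod_cast h
      rw [Real.exp_neg, ← mul_assoc, eq_mul_inv_iff_mul_eq₀ (Real.exp_pos _).ne', h2, one_mul]
    have hd1 : HasDerivAt (fun s : ℝ => Psi F 0 *
        ((1 + (Real.exp s - 1) * ((d : ℝ) / N)) * Real.exp (-(((d : ℝ) / N) * s)))) 0 0 := by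
      have h1 : HasDerivAt (fun s : ℝ => 1 + (Real.exp s - 1) * ((d : ℝ) / N))
        (Real.exp 0 * ((d : ℝ) / N)) 0 :=
        (((Real.hasDerivAt_exp 0).sub_const 1).mul_const _).const_add 1
      have h2 : HasDerivAt (fun s : ℝ => Real.exp (-(((d : ℝ) / N) * s)))
        (Real.exp (-(((d : ℝ) / N) * 0)) * (-(((d : ℝ) / N) * 1))) 0 :=
        ((hasDerivAt_id (0:ℝ)).const_mul ((d : ℝ) / N)).neg.exp
      have h3 := (h1.mul h2).const_mul (Psi F 0)
      refine h3.congr_deriv ?_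
      simp
    have hd2 : HasDerivAt (fun s : ℝ => Psi F (Pi.single n s))
        (∑ p : Fin d → Fin N, cp F p * LL p (Pi.single n (1:ℝ))) 0 := by
      unfold Psi
      have hs : ∀ s : ℝ, (Pi.single n s : Fin N → ℝ) = s • Pi.single n (1:ℝ) := by
        intro s
        rw [← Pi.single_smul]
        simp
      apply HasDerivAt.fun_sum
      intro p _
      have h1 : HasDerivAt (fun s : ℝ => s * LL p (Pi.single n (1:ℝ)))
        (1 * LL p (Pi.single n (1:ℝ))) 0 := (hasDerivAt_id (0:ℝ)).mul_const _
      have h2 := h1.exp.const_mul (cp F p)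
      have h3 : (fun s : ℝ => cp F p * Real.exp (LL p (Pi.single n s))) =
          (fun s : ℝ => cp F p * Real.exp (s * LL p (Pi.single n (1:ℝ)))) := by
        ext s
        rw [hs s, map_smul, smul_eq_mul]
      rw [h3]
      refine h2.congr_deriv ?_
      simp
    have h4 : (fun s : ℝ => Psi F (Pi.single n s)) = _ := funext h1
    rw [h4] at hd2
    exact hd2.unique hd1
  have hall : ∑ p : Fin d → Fin N, cp F p * LL p t = 0 := by
    have h1 : ∀ p : Fin d → Fin N, LL p t = ∑ n, t n * LL p (Pi.single n (1:ℝ)) := by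
      intro p
      conv_lhs => rw [pi_eq_sum_univ' t]
      rw [map_sum]
      refine Finset.sum_congr rfl fun n _ => ?_
      rw [map_smul, smul_eq_mul]
    simp_rw [h1, Finset.mul_sum]
    rw [Finset.sum_comm]
    apply Finset.sum_eq_zero
    intro n _
    have := hsingle n
    calc ∑ p : Fin d → Fin N, cp F p * (t n * LL p (Pi.single n (1:ℝ)))
        = t n * ∑ p : Fin d → Fin N, cp F p * LL p (Pi.single n (1:ℝ)) := by
          rw [Finset.mul_sum]
          refine Finset.sum_congr rfl fun p _ => by ring
      _ = 0 := by rw [this, mul_zero]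
  have h5 : Psi F 0 = ∑ p : Fin d → Fin N, cp F p * (LL p t + 1) := by
    simp only [mul_add, Finset.sum_add_distrib, hall, zero_add]
    simp [Psi]
  rw [h5]
  apply Finset.sum_le_sum
  intro p _
  exact mul_le_mul_of_nonneg_left (Real.add_one_le_exp _) (cp_nonneg F p)

lemma exists_tau {N d : ℕ} {F : Matrix (Fin d) (Fin N) ℂ} (hF : Stable F) :
    ∃ t ∈ HH N, ∀ t' ∈ HH N, t' ≠ t → Psi F t < Psi F t' := by
  have hsc := expsum_strictConvex (HH N) (cp F) LL (cp_nonneg F) (stable_sep hF)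
  obtain ⟨t, ht, hmin⟩ := expsum_exists_min (HH N) (cp F) LL (cp_nonneg F) (stable_sep hF)
  refine ⟨t, ht, fun t' ht' hne => ?_⟩
  refine lt_of_le_of_ne (hmin t' ht') ?_
  intro heq
  apply hne
  refine hsc.eq_of_isMinOn (fun y hy => ?_) (fun y hy => hmin y hy) ht' ht
  have : Psi F t ≤ Psi F y := hmin y hy
  rw [heq] at this
  exact this

/-- The scaling vector. -/
def tau {N d : ℕ} (F : {F : Matrix (Fin d) (Fin N) ℂ // Stable F}) : Fin N → ℝ :=
  Classical.choose (exists_tau F.2)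

lemma tau_mem {N d : ℕ} (F : {F : Matrix (Fin d) (Fin N) ℂ // Stable F}) : tau F ∈ HH N :=
  (Classical.choose_spec (exists_tau F.2)).1

lemma tau_min {N d : ℕ} (F : {F : Matrix (Fin d) (Fin N) ℂ // Stable F}) :
    ∀ t' ∈ HH N, t' ≠ tau F → Psi F.1 (tau F) < Psi F.1 t' :=
  (Classical.choose_spec (exists_tau F.2)).2

lemma tau_min_le {N d : ℕ} (F : {F : Matrix (Fin d) (Fin N) ℂ // Stable F}) :
    ∀ t' ∈ HH N, Psi F.1 (tau F) ≤ Psi F.1 t' := by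
  intro t' ht'
  by_cases h : t' = tau F
  · rw [h]
  · exact (tau_min F t' ht' h).le

lemma tau_continuous {N d : ℕ} :
    Continuous (tau : {F : Matrix (Fin d) (Fin N) ℂ // Stable F} → Fin N → ℝ) := by
  refine continuous_minimizer (X := {F : Matrix (Fin d) (Fin N) ℂ // Stable F})
    (HH N : Set (Fin N → ℝ)) (HH N).closed_of_finiteDimensional
    (fun F t => Psi F.1 t) ?_ ?_ tau (fun F => tau_mem F) ?_
  · change Continuous (fun q : {F : Matrix (Fin d) (Fin N) ℂ // Stable F} × (Fin N → ℝ) =>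
      ∑ p : Fin d → Fin N, cp q.1.1 p * Real.exp (LL p q.2))
    apply continuous_finsetSum
    intro p _
    have h1 : Continuous (LL p) := LinearMap.continuous_of_finiteDimensional _
    have h2 : Continuous (fun F : Matrix (Fin d) (Fin N) ℂ => cp F p) := by
      unfold cp
      exact Complex.continuous_normSq.comp
        (Continuous.matrix_det (continuous_id.matrix_submatrix _ _))
    exact (h2.comp (continuous_subtype_val.comp continuous_fst)).mul
      (Real.continuous_exp.comp (h1.comp continuous_snd))
  · intro F
    have h := (expsum_strictConvex (HH N) (cp F.1) LL (cp_nonneg F.1) (stable_sep F.2)).convexOn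
    exact h
  · intro F t ht hne
    exact tau_min F t ht hne

lemma rk_le_of_eq {N d : ℕ} {F G : Matrix (Fin d) (Fin N) ℂ} (A : Matrix (Fin d) (Fin d) ℂ)
    (c : Fin N → ℂ) (h : F = A * G * Matrix.diagonal c) (S : Finset (Fin N)) :
    rk F S ≤ rk G S := by
  have hcol : ∀ n, col F n = c n • Matrix.toEuclideanLin A (col G n) := by
    intro n
    ext i
    rw [h]
    change (A * G * Matrix.diagonal c) i n = c n * (A.mulVec (fun i => G i n)) i
    rw [Matrix.mul_diagonal, mul_comm]
    rfl
  have hle : Submodule.span ℂ (col F '' (S : Set (Fin N))) ≤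
      (Submodule.span ℂ (col G '' (S : Set (Fin N)))).map (Matrix.toEuclideanLin A) := by
    rw [Submodule.span_le]
    rintro _ ⟨n, hn, rfl⟩
    rw [hcol]
    exact Submodule.smul_mem _ _ (Submodule.mem_map_of_mem
      (Submodule.subset_span (Set.mem_image_of_mem _ hn)))
  exact (Submodule.finrank_mono hle).trans (Submodule.finrank_map_le _ _)

/-- Scaling a stable matrix to a unit norm tight frame. -/
def Theta {N d : ℕ} (F : {F : Matrix (Fin d) (Fin N) ℂ // Stable F}) :
    Matrix (Fin d) (Fin N) ℂ :=
  ((Real.sqrt ((N : ℝ) / d) : ℝ) : ℂ) • (invSqrt (MM F.1 (ex (tau F))) * F.1 *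
    Matrix.diagonal (fun n => ((Real.exp (tau F n / 2) : ℝ) : ℂ)))

lemma Theta_posDef {N d : ℕ} (F : {F : Matrix (Fin d) (Fin N) ℂ // Stable F}) :
    (MM F.1 (ex (tau F))).PosDef := MM_ex_posDef (exists_cp_pos F.2.1) _

lemma diag_half {N : ℕ} (t : Fin N → ℝ) :
    Matrix.diagonal (fun n => ((Real.exp (t n / 2) : ℝ) : ℂ)) *
      Matrix.diagonal (fun n => ((Real.exp (t n / 2) : ℝ) : ℂ)) =
      Matrix.diagonal (fun n => ((ex t n : ℝ) : ℂ)) := by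
  rw [Matrix.diagonal_mul_diagonal]
  congr 1
  ext n
  rw [← Complex.ofReal_mul, ← Real.exp_add, add_halves, ex]

lemma diag_half_herm {N : ℕ} (t : Fin N → ℝ) :
    (Matrix.diagonal (fun n => ((Real.exp (t n / 2) : ℝ) : ℂ))).conjTranspose =
      Matrix.diagonal (fun n => ((Real.exp (t n / 2) : ℝ) : ℂ)) := by
  rw [Matrix.diagonal_conjTranspose]
  congr 1
  ext n
  simp only [Pi.star_apply, RCLike.star_def, Complex.conj_ofReal]

lemma sqrt_sq_cast {N d : ℕ} : ((Real.sqrt ((N : ℝ) / d) : ℝ) : ℂ) *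
    ((Real.sqrt ((N : ℝ) / d) : ℝ) : ℂ) = (N : ℂ) / d := by
  rw [← Complex.ofReal_mul, Real.mul_self_sqrt (by positivity)]
  push_cast
  rfl

lemma Theta_funtf {N d : ℕ} (hd : 1 ≤ d) (hdN : d ≤ N)
    (F : {F : Matrix (Fin d) (Fin N) ℂ // Stable F}) : Theta F ∈ FUNTF ℂ N d := by
  have hM := Theta_posDef F
  have h1 := invSqrt_mul hM
  constructor
  · rw [Theta, Matrix.conjTranspose_smul, Matrix.smul_mul, Matrix.mul_smul, smul_smul]
    simp only [RCLike.star_def, Complex.conj_ofReal]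
    rw [sqrt_sq_cast]
    congr 1
    rw [Matrix.conjTranspose_mul, Matrix.conjTranspose_mul, diag_half_herm, invSqrt_herm]
    have h2 : MM F.1 (ex (tau F)) = F.1 *
        (Matrix.diagonal (fun n => ((Real.exp (tau F n / 2) : ℝ) : ℂ)) *
        Matrix.diagonal (fun n => ((Real.exp (tau F n / 2) : ℝ) : ℂ))) * F.1.conjTranspose := by
      rw [diag_half, MM]
    rw [← h1]
    generalize invSqrt (MM F.1 (ex (tau F))) = R
    rw [h2]
    simp only [Matrix.mul_assoc]
  · intro n
    have hinv : (MM F.1 (ex (tau F)))⁻¹ =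
        invSqrt (MM F.1 (ex (tau F))) * invSqrt (MM F.1 (ex (tau F))) := by
      apply Matrix.inv_eq_right_inv
      rw [Matrix.mul_assoc, mul_eq_one_comm] at h1
      rw [← Matrix.mul_assoc, h1]
    have hl := lev_of_min (by omega) (exists_cp_pos F.2.1) (tau F) (tau_min_le F) n
    rw [lev, hinv] at hl
    rw [Theta, Matrix.conjTranspose_smul, Matrix.smul_mul, Matrix.mul_smul, smul_smul]
    simp only [RCLike.star_def, Complex.conj_ofReal]
    rw [sqrt_sq_cast]
    rw [Matrix.conjTranspose_mul, Matrix.conjTranspose_mul, diag_half_herm, invSqrt_herm]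
    have e : (Matrix.diagonal (fun n => ((Real.exp (tau F n / 2) : ℝ) : ℂ)) *
        (F.1.conjTranspose * invSqrt (MM F.1 (ex (tau F)))) *
        (invSqrt (MM F.1 (ex (tau F))) * F.1 *
          Matrix.diagonal (fun n => ((Real.exp (tau F n / 2) : ℝ) : ℂ)))) n n =
        (ex (tau F) n : ℂ) * (F.1.conjTranspose * (invSqrt (MM F.1 (ex (tau F))) *
          invSqrt (MM F.1 (ex (tau F)))) * F.1) n n := by
      rw [← Matrix.mul_assoc, Matrix.mul_diagonal]
      rw [Matrix.mul_assoc, Matrix.diagonal_mul]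
      have : ((ex (tau F) n : ℝ) : ℂ) = ((Real.exp (tau F n / 2) : ℝ) : ℂ) *
          ((Real.exp (tau F n / 2) : ℝ) : ℂ) := by
        rw [← Complex.ofReal_mul, ← Real.exp_add, add_halves, ex]
      rw [this]
      simp only [Matrix.mul_assoc]
      ring
    rw [Matrix.smul_apply, e, hl]
    have : (N : ℂ) ≠ 0 := by exact_mod_cast (by omega : N ≠ 0)
    have : (d : ℂ) ≠ 0 := by exact_mod_cast (by omega : d ≠ 0)
    push_cast
    rw [smul_eq_mul]
    field_simp

lemma Theta_continuous {N d : ℕ} :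
    Continuous (Theta : {F : Matrix (Fin d) (Fin N) ℂ // Stable F} → _) := by
  unfold Theta
  have ht : ∀ n, Continuous (fun F : {F : Matrix (Fin d) (Fin N) ℂ // Stable F} => tau F n) :=
    fun n => (continuous_apply n).comp tau_continuous
  have h1 : Continuous (fun F : {F : Matrix (Fin d) (Fin N) ℂ // Stable F} =>
      MM F.1 (ex (tau F))) := by
    unfold MM ex
    refine (continuous_subtype_val.matrix_mul (Continuous.matrix_diagonal
      (continuous_pi fun n => ?_))).matrix_mul continuous_subtype_val.matrix_conjTranspose
    exact Complex.continuous_ofReal.comp (Real.continuous_exp.comp (ht n))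
  have h2 : Continuous (fun F : {F : Matrix (Fin d) (Fin N) ℂ // Stable F} =>
      invSqrt (MM F.1 (ex (tau F)))) :=
    (invSqrt_continuousOn d).comp_continuous h1 Theta_posDef
  refine Continuous.fun_const_smul (M := ℂ) ((h2.matrix_mul continuous_subtype_val).matrix_mul
    (Continuous.matrix_diagonal (continuous_pi fun n => ?_))) _
  exact Complex.continuous_ofReal.comp (Real.continuous_exp.comp ((ht n).div_const 2))

lemma MM_zero_of_funtf {N d : ℕ} {F : Matrix (Fin d) (Fin N) ℂ} (hF : F ∈ FUNTF ℂ N d) :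
    MM F (ex 0) = (((N : ℝ) / d : ℝ) : ℂ) • 1 := by
  rw [MM]
  have : Matrix.diagonal (fun n => ((ex (0 : Fin N → ℝ) n : ℝ) : ℂ)) = 1 := by
    simp [ex]
  rw [this, Matrix.mul_one, hF.1]
  push_cast
  rfl

lemma tau_of_funtf {N d : ℕ} (hd : 1 ≤ d) (hdN : d ≤ N)
    (F : {F : Matrix (Fin d) (Fin N) ℂ // Stable F}) (hF : F.1 ∈ FUNTF ℂ N d) :
    tau F = 0 := by
  by_contra hne
  have hN : (N : ℂ) ≠ 0 := by exact_mod_cast (by omega : N ≠ 0)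
  have hd' : (d : ℂ) ≠ 0 := by exact_mod_cast (by omega : d ≠ 0)
  have h1 := tau_min F 0 (HH N).zero_mem (Ne.symm hne)
  have h2 := Psi_min_of_lev (exists_cp_pos F.2.1) (fun n => by
    rw [lev, MM_zero_of_funtf hF]
    have : ((((N : ℝ) / d : ℝ) : ℂ) • (1 : Matrix (Fin d) (Fin d) ℂ))⁻¹ =
        (((d : ℝ) / N : ℝ) : ℂ) • 1 := by
      apply Matrix.inv_eq_right_inv
      rw [Matrix.smul_mul, Matrix.mul_smul, smul_smul, Matrix.one_mul]
      have : (((N : ℝ) / d : ℝ) : ℂ) * (((d : ℝ) / N : ℝ) : ℂ) = 1 := by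
        push_cast
        field_simp
      rw [this, one_smul]
    rw [this, Matrix.mul_smul, Matrix.smul_mul, Matrix.mul_one, Matrix.smul_apply, hF.2 n]
    simp) (tau F)
  linarith

lemma Theta_of_funtf {N d : ℕ} (hd : 1 ≤ d) (hdN : d ≤ N)
    (F : {F : Matrix (Fin d) (Fin N) ℂ // Stable F}) (hF : F.1 ∈ FUNTF ℂ N d) :
    Theta F = F.1 := by
  have hpos : 0 < Real.sqrt ((N : ℝ) / d) := by
    apply Real.sqrt_pos.2
    have : 0 < (N : ℝ) := by exact_mod_cast (by omega : 0 < N)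
    have : 0 < (d : ℝ) := by exact_mod_cast (by omega : 0 < d)
    positivity
  rw [Theta, tau_of_funtf hd hdN F hF, MM_zero_of_funtf hF, invSqrt_smul_one]
  have : Matrix.diagonal (fun n => ((Real.exp ((0 : Fin N → ℝ) n / 2) : ℝ) : ℂ)) = 1 := by
    simp
  rw [this, Matrix.mul_one, Matrix.smul_mul, Matrix.one_mul, smul_smul, ← Complex.ofReal_mul,
    mul_inv_cancel₀ hpos.ne']
  simp

lemma rk_Theta {N d : ℕ} (hd : 1 ≤ d) (hdN : d ≤ N)
    (F : {F : Matrix (Fin d) (Fin N) ℂ // Stable F}) (S : Finset (Fin N)) :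
    rk F.1 S ≤ rk (Theta F) S := by
  have hpos : ((Real.sqrt ((N : ℝ) / d) : ℝ) : ℂ) ≠ 0 := by
    intro h
    have h2 := sqrt_sq_cast (N := N) (d := d)
    have hN : (N : ℂ) ≠ 0 := by exact_mod_cast (by omega : N ≠ 0)
    have hd' : (d : ℂ) ≠ 0 := by exact_mod_cast (by omega : d ≠ 0)
    rw [h, mul_zero] at h2
    exact div_ne_zero hN hd' h2.symm
  have h1 := invSqrt_mul (Theta_posDef F)
  rw [Matrix.mul_assoc, mul_eq_one_comm] at h1
  refine rk_le_of_eq ((((Real.sqrt ((N : ℝ) / d) : ℝ) : ℂ)⁻¹) •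
    (MM F.1 (ex (tau F)) * invSqrt (MM F.1 (ex (tau F)))))
    (fun n => ((Real.exp (- (tau F n / 2)) : ℝ) : ℂ)) ?_ S
  have h3 : Matrix.diagonal (fun n => ((Real.exp (tau F n / 2) : ℝ) : ℂ)) *
      Matrix.diagonal (fun n => ((Real.exp (- (tau F n / 2)) : ℝ) : ℂ)) = 1 := by
    rw [Matrix.diagonal_mul_diagonal, ← Matrix.diagonal_one]
    congr 1
    ext n
    rw [← Complex.ofReal_mul, ← Real.exp_add, add_neg_cancel, Real.exp_zero, Complex.ofReal_one]
  rw [Theta]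
  simp only [Matrix.smul_mul, Matrix.mul_smul, smul_smul]
  rw [mul_inv_cancel₀ hpos, one_smul]
  rw [Matrix.mul_assoc _ _ (Matrix.diagonal _), Matrix.mul_assoc _ _ (Matrix.diagonal _), h3,
    Matrix.mul_one, ← Matrix.mul_assoc, h1, Matrix.one_mul]

lemma frame_identity {N d : ℕ} {F : Matrix (Fin d) (Fin N) ℂ} (hF : F ∈ FUNTF ℂ N d)
    (x : EuclideanSpace ℂ (Fin d)) :
    ∑ n, inner ℂ (col F n) x • col F n = ((N : ℂ) / d) • x := by
  have h1 : (F * F.conjTranspose).mulVec x.ofLp = ((N : ℂ) / d) • x.ofLp := by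
    rw [hF.1, Matrix.smul_mulVec, Matrix.one_mulVec]
  rw [← Matrix.mulVec_mulVec] at h1
  ext i
  have h2 := congrFun h1 i
  have h3 : (((N : ℂ) / d) • x) i = (((N : ℂ) / d) • x.ofLp) i := rfl
  rw [h3, ← h2]
  simp only [Matrix.mulVec, dotProduct, Matrix.conjTranspose_apply]
  rw [WithLp.ofLp_sum, Finset.sum_apply]
  refine Finset.sum_congr rfl fun n _ => ?_
  simp only [PiLp.smul_apply, smul_eq_mul, PiLp.inner_apply, RCLike.inner_apply]
  rw [mul_comm]
  congr 1
  refine Finset.sum_congr rfl fun j _ => ?_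
  rw [mul_comm]
  rfl

lemma frame_tight {N d : ℕ} {F : Matrix (Fin d) (Fin N) ℂ} (hF : F ∈ FUNTF ℂ N d)
    (x : EuclideanSpace ℂ (Fin d)) :
    ∑ n, ‖inner ℂ x (col F n)‖ ^ 2 = ((N : ℝ) / d) * ‖x‖ ^ 2 := by
  have h := congrArg (fun y => inner ℂ x y) (frame_identity hF x)
  simp only [inner_sum, inner_smul_right, inner_self_eq_norm_sq_to_K] at h
  have h2 : ∀ n, inner ℂ (col F n) x * inner ℂ x (col F n) =
      ((‖inner ℂ x (col F n)‖ ^ 2 : ℝ) : ℂ) := by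
    intro n
    rw [← inner_conj_symm (col F n) x, RCLike.conj_mul]
    push_cast
    rfl
  simp only [h2] at h
  have h3 : ((∑ n, ‖inner ℂ x (col F n)‖ ^ 2 : ℝ) : ℂ) =
      ((((N : ℝ) / d) * ‖x‖ ^ 2 : ℝ) : ℂ) := by
    push_cast at h ⊢
    exact h
  exact_mod_cast h3

lemma col_norm {N d : ℕ} {F : Matrix (Fin d) (Fin N) ℂ} (hF : F ∈ FUNTF ℂ N d) (n : Fin N) :
    ‖col F n‖ ^ 2 = 1 := by
  have h := hF.2 n
  have h1 : inner ℂ (col F n) (col F n) = (F.conjTranspose * F) n n := by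
    rw [Matrix.mul_apply]
    simp only [PiLp.inner_apply, RCLike.inner_apply, Matrix.conjTranspose_apply]
    refine Finset.sum_congr rfl fun j _ => ?_
    rw [mul_comm]
    rfl
  rw [h, inner_self_eq_norm_sq_to_K] at h1
  have h2 : (((‖col F n‖ ^ 2 : ℝ)) : ℂ) = ((1 : ℝ) : ℂ) := by
    push_cast
    exact h1
  exact Complex.ofReal_injective h2

/-- Squared length of the projection of the `n`-th column to the span of `S`. -/
def qq {N d : ℕ} (F : Matrix (Fin d) (Fin N) ℂ) (S : Finset (Fin N)) (n : Fin N) : ℝ :=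
  ∑ j, ‖inner ℂ ((stdOrthonormalBasis ℂ (Submodule.span ℂ (col F '' (S : Set (Fin N)))) j :
    Submodule.span ℂ (col F '' (S : Set (Fin N)))) : EuclideanSpace ℂ (Fin d)) (col F n)‖ ^ 2

lemma qq_nonneg {N d : ℕ} (F : Matrix (Fin d) (Fin N) ℂ) (S : Finset (Fin N)) (n : Fin N) :
    0 ≤ qq F S n := Finset.sum_nonneg fun _ _ => by positivity

lemma qq_sum {N d : ℕ} {F : Matrix (Fin d) (Fin N) ℂ} (hF : F ∈ FUNTF ℂ N d)
    (S : Finset (Fin N)) : ∑ n, qq F S n = ((N : ℝ) / d) * rk F S := by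
  unfold qq
  rw [Finset.sum_comm]
  simp only [frame_tight hF]
  have : ∀ j, ‖((stdOrthonormalBasis ℂ (Submodule.span ℂ (col F '' (S : Set (Fin N)))) j :
    Submodule.span ℂ (col F '' (S : Set (Fin N)))) : EuclideanSpace ℂ (Fin d))‖ = 1 :=
    fun j => (stdOrthonormalBasis ℂ _).norm_eq_one j
  simp [this, rk, mul_comm]

lemma qq_mem {N d : ℕ} {F : Matrix (Fin d) (Fin N) ℂ} (hF : F ∈ FUNTF ℂ N d)
    (S : Finset (Fin N)) {n : Fin N} (hn : n ∈ S) : qq F S n = 1 := by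
  have hmem : col F n ∈ Submodule.span ℂ (col F '' (S : Set (Fin N))) :=
    Submodule.subset_span ⟨n, hn, rfl⟩
  have h := (stdOrthonormalBasis ℂ (Submodule.span ℂ (col F '' (S : Set (Fin N))))
    ).sum_sq_norm_inner_right ⟨col F n, hmem⟩
  rw [← col_norm hF n]
  exact h

lemma qq_eq_zero {N d : ℕ} {F : Matrix (Fin d) (Fin N) ℂ}
    (S : Finset (Fin N)) (n : Fin N) : qq F S n = 0 ↔
      col F n ∈ (Submodule.span ℂ (col F '' (S : Set (Fin N))))ᗮ := by
  constructor
  · intro h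
    rw [Submodule.mem_orthogonal]
    intro u hu
    unfold qq at h
    rw [Finset.sum_eq_zero_iff_of_nonneg (fun _ _ => by positivity)] at h
    have h1 := (stdOrthonormalBasis ℂ (Submodule.span ℂ (col F '' (S : Set (Fin N))))
      ).sum_repr ⟨u, hu⟩
    have h2 := congrArg Subtype.val h1
    simp only [Submodule.coe_sum, Submodule.coe_smul] at h2
    rw [← h2, sum_inner]
    apply Finset.sum_eq_zero
    intro j hj
    have h3 := h j hj
    rw [sq_eq_zero_iff, norm_eq_zero] at h3
    rw [inner_smul_left, h3, mul_zero]
  · intro h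
    unfold qq
    apply Finset.sum_eq_zero
    intro j _
    rw [(Submodule.mem_orthogonal _ _).1 h _ (Submodule.coe_mem _)]
    simp

lemma stable_of_nod {N d : ℕ} (hd : 1 ≤ d) (hdN : d ≤ N) {F : Matrix (Fin d) (Fin N) ℂ}
    (hF : F ∈ FUNTF ℂ N d) (hnod : ¬ Orthodecomposable ℂ (col F)) : Stable F := by
  classical
  have hN : (N : ℂ) ≠ 0 := by exact_mod_cast (by omega : N ≠ 0)
  have hd' : (d : ℂ) ≠ 0 := by exact_mod_cast (by omega : d ≠ 0)
  have hNd : (N : ℂ) / d ≠ 0 := div_ne_zero hN hd'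
  have hspan : ∀ (S : Finset (Fin N)) (x : EuclideanSpace ℂ (Fin d)),
      (∀ n, n ∉ S → inner ℂ (col F n) x = 0) →
      x ∈ Submodule.span ℂ (col F '' (S : Set (Fin N))) := by
    intro S x hx
    rw [← Submodule.smul_mem_iff _ hNd, ← frame_identity hF x]
    apply Submodule.sum_mem
    intro n _
    by_cases hn : n ∈ S
    · exact Submodule.smul_mem _ _ (Submodule.subset_span ⟨n, hn, rfl⟩)
    · rw [hx n hn, zero_smul]
      exact Submodule.zero_mem _
  constructor
  · have : Submodule.span ℂ (col F '' ((Finset.univ : Finset (Fin N)) : Set (Fin N))) = ⊤ := by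
      rw [eq_top_iff]
      intro x _
      exact hspan _ x (fun n hn => absurd (Finset.mem_univ n) hn)
    rw [rk, this, finrank_top, finrank_euclideanSpace_fin]
  · intro S hS hS'
    by_contra hlt
    push Not at hlt
    apply hnod
    have hsum := qq_sum hF S
    rw [← Finset.sum_add_sum_compl S, Finset.sum_congr rfl (fun n hn => qq_mem hF S hn)] at hsum
    have hdpos : (0 : ℝ) < d := by exact_mod_cast (by omega : 0 < d)
    have hlt' : (N : ℝ) * rk F S ≤ d * S.card := by exact_mod_cast hlt
    have hle : ((N : ℝ) / d) * rk F S ≤ S.card := by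
      rw [div_mul_eq_mul_div, div_le_iff₀ hdpos]
      linarith
    have hz : ∑ n ∈ Sᶜ, qq F S n = 0 := by
      apply le_antisymm
      · simp only [Finset.sum_const, nsmul_eq_mul, mul_one] at hsum
        linarith
      · exact Finset.sum_nonneg fun n _ => qq_nonneg F S n
    rw [Finset.sum_eq_zero_iff_of_nonneg (fun n _ => qq_nonneg F S n)] at hz
    have hperp : ∀ n, n ∉ S → col F n ∈ (Submodule.span ℂ (col F '' (S : Set (Fin N))))ᗮ :=
      fun n hn => (qq_eq_zero S n).1 (hz n (Finset.mem_compl.2 hn))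
    refine ⟨S, (S : Set (Fin N))ᶜ, hS, ?_, disjoint_compl_right, Set.union_compl_self _, ?_⟩
    · rw [Set.nonempty_compl]
      intro h
      exact hS' (by exact_mod_cast h)
    · apply le_antisymm
      · rw [← Submodule.le_orthogonal_iff_le_orthogonal, Submodule.span_le]
        rintro _ ⟨n, hn, rfl⟩
        exact hperp n (by simpa using hn)
      · intro x hx
        apply hspan
        intro n hn
        exact (Submodule.mem_orthogonal _ _).1 hx _ (Submodule.subset_span ⟨n, by simpa using hn, rfl⟩)

lemma nod_of_strict {N d : ℕ} (hd : 1 ≤ d) {F : Matrix (Fin d) (Fin N) ℂ}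
    (hF : F ∈ FUNTF ℂ N d)
    (hst : ∀ S : Finset (Fin N), S.Nonempty → S ≠ Finset.univ → d * S.card < N * rk F S) :
    ¬ Orthodecomposable ℂ (col F) := by
  classical
  rintro ⟨S, T, hS, hT, hdisj, hun, hsp⟩
  obtain ⟨S, rfl⟩ : ∃ S' : Finset (Fin N), (S' : Set (Fin N)) = S :=
    ⟨S.toFinite.toFinset, by simp⟩
  have h1 := hst S (by simpa using hS) (by
    rintro rfl
    obtain ⟨t, ht⟩ := hT
    exact Set.disjoint_left.1 hdisj (by simp) ht)
  have hsum := qq_sum hF S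
  rw [← Finset.sum_add_sum_compl S, Finset.sum_congr rfl (fun n hn => qq_mem hF S hn)] at hsum
  have hz : ∑ n ∈ Sᶜ, qq F S n = 0 := by
    apply Finset.sum_eq_zero
    intro n hn
    rw [qq_eq_zero, hsp]
    apply Submodule.le_orthogonal_orthogonal
    apply Submodule.subset_span
    refine ⟨n, ?_, rfl⟩
    have : n ∈ (S : Set (Fin N)) ∪ T := by rw [hun]; trivial
    rcases this with h | h
    · exact absurd h (by simpa using hn)
    · exact h
  have hdpos : (0 : ℝ) < d := by exact_mod_cast (by omega : 0 < d)
  simp only [Finset.sum_const, nsmul_eq_mul, mul_one, hz, add_zero] at hsum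
  have h2 : (d : ℝ) * S.card < N * rk F S := by exact_mod_cast h1
  rw [hsum] at h2
  field_simp at h2
  exact lt_irrefl _ h2

lemma finite_not_linearIndependent {d r : ℕ} (v w : Fin r → EuclideanSpace ℂ (Fin d))
    (hv : LinearIndependent ℂ v) :
    {z : ℂ | ¬ LinearIndependent ℂ (fun j => v j + z • w j)}.Finite := by
  have hinj : LinearMap.ker (Fintype.linearCombination ℂ v) = ⊥ := by
    rw [LinearMap.ker_eq_bot]
    exact linearIndependent_iff_injective_fintypeLinearCombination.1 hv
  obtain ⟨L, hL⟩ := LinearMap.exists_leftInverse_of_injective _ hinj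
  have hLv : ∀ j, L (v j) = Pi.single j 1 := by
    intro j
    have := LinearMap.congr_fun hL (Pi.single j 1)
    simpa [Fintype.linearCombination_apply_single] using this
  let M : Matrix (Fin r) (Fin r) ℂ := Matrix.of fun i j => L (w j) i
  let P : Polynomial ℂ := (1 + (Polynomial.X : Polynomial ℂ) • M.map Polynomial.C).det
  have hP : ∀ z, P.eval z = (1 + z • M).det := by
    intro z
    rw [← Polynomial.coe_evalRingHom, RingHom.map_det]
    congr 1
    ext i j
    by_cases h : i = j <;> simp [h] <;> ring
  have hP0 : P ≠ 0 := by
    intro h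
    have := hP 0
    rw [h] at this
    simp at this
  refine (Polynomial.finite_setOfPred_isRoot hP0).subset ?_
  intro z hz
  by_contra hroot
  apply hz
  have hdet : (1 + z • M).det ≠ 0 := by
    rw [← hP]
    exact hroot
  have h1 : LinearIndependent ℂ (1 + z • M).col := by
    rw [Matrix.linearIndependent_cols_iff_isUnit, Matrix.isUnit_iff_isUnit_det]
    exact isUnit_iff_ne_zero.2 hdet
  apply LinearIndependent.of_comp L
  have e : (L ∘ fun j => v j + z • w j) = (1 + z • M).col := by
    ext j i
    simp [hLv, M, Matrix.col, Matrix.one_apply, Pi.single_apply]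
  rw [e]
  exact h1

lemma finite_not_stable {N d : ℕ} {F : Matrix (Fin d) (Fin N) ℂ} (hF : Stable F)
    (W : Matrix (Fin d) (Fin N) ℂ) : {z : ℂ | ¬ Stable (F + z • W)}.Finite := by
  have hS : ∀ S : Finset (Fin N), {z : ℂ | ¬ rk F S ≤ rk (F + z • W) S}.Finite := by
    intro S
    obtain ⟨g, hg, -, hli⟩ := Submodule.exists_fun_fin_finrank_span_eq ℂ
      (col F '' (S : Set (Fin N)))
    choose q hq1 hq2 using hg
    have hli2 : LinearIndependent ℂ (fun i => col F (q i)) := by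
      have : (fun i => col F (q i)) = g := funext hq2
      rw [this]
      exact hli
    refine (finite_not_linearIndependent _ (fun i => col W (q i)) hli2).subset ?_
    intro z hz hlin
    apply hz
    have e : ∀ i, col F (q i) + z • col W (q i) = col (F + z • W) (q i) := fun i => rfl
    simp only [e] at hlin
    have h2 := finrank_span_eq_card hlin
    rw [Fintype.card_fin] at h2
    unfold rk
    rw [← h2]
    apply Submodule.finrank_mono
    apply Submodule.span_mono
    rintro _ ⟨i, rfl⟩
    exact ⟨q i, hq1 i, rfl⟩
  refine (Set.finite_iUnion hS).subset ?_
  intro z hz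
  by_contra hcon
  apply hz
  simp only [Set.mem_iUnion, Set.mem_ofPred_eq, not_exists, not_not] at hcon
  exact ⟨hF.1.trans (hcon _), fun S h1 h2 => (hF.2 S h1 h2).trans_le
    (Nat.mul_le_mul_left _ (hcon S))⟩

lemma stable_joined {N d : ℕ} {F G : Matrix (Fin d) (Fin N) ℂ} (hF : Stable F) (hG : Stable G) :
    Joined (⟨F, hF⟩ : {F : Matrix (Fin d) (Fin N) ℂ // Stable F}) ⟨G, hG⟩ := by
  have hfin := finite_not_stable hF (G - F)
  have hrank : 1 < Module.rank ℝ ℂ := by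
    rw [Complex.rank_real_complex]
    norm_num
  have hpc := hfin.countable.isPathConnected_compl_of_one_lt_rank hrank
  have h0 : (0 : ℂ) ∈ {z : ℂ | ¬ Stable (F + z • (G - F))}ᶜ := by simpa using hF
  have h1 : (1 : ℂ) ∈ {z : ℂ | ¬ Stable (F + z • (G - F))}ᶜ := by simpa using hG
  obtain ⟨γ, hγ⟩ := hpc.joinedIn 0 h0 1 h1
  refine ⟨⟨⟨fun s => ⟨F + γ s • (G - F), by simpa using hγ s⟩, ?_⟩, ?_, ?_⟩⟩
  · refine Continuous.subtype_mk ?_ _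
    exact continuous_const.add (γ.continuous.smul continuous_const)
  · simp
  · simp

end NODAux

/-- For `N ≥ d ≥ 1`, any two non-orthodecomposable frames in `𝓕_{N,d}^ℂ` are joined by a
continuous path inside `𝓕_{N,d}^ℂ` all of whose points are non-orthodecomposable. -/
theorem nod_pathConnected_complex (N d : ℕ) (hd : 1 ≤ d) (hdN : d ≤ N) :
    ∀ F ∈ {F ∈ FUNTF ℂ N d | ¬ Orthodecomposable ℂ (col F)},
      ∀ G ∈ {F ∈ FUNTF ℂ N d | ¬ Orthodecomposable ℂ (col F)},
        JoinedIn {F ∈ FUNTF ℂ N d | ¬ Orthodecomposable ℂ (col F)} F G := by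
  rintro F ⟨hF, hFn⟩ G ⟨hG, hGn⟩
  obtain ⟨γ⟩ := stable_joined (stable_of_nod hd hdN hF hFn) (stable_of_nod hd hdN hG hGn)
  refine ⟨⟨⟨fun s => Theta (γ s), Theta_continuous.comp γ.continuous⟩, ?_, ?_⟩, ?_⟩
  · change Theta (γ 0) = F
    rw [γ.source, Theta_of_funtf hd hdN _ hF]
  · change Theta (γ 1) = G
    rw [γ.target, Theta_of_funtf hd hdN _ hG]
  · intro s
    exact ⟨Theta_funtf hd hdN _, nod_of_strict hd (Theta_funtf hd hdN _) fun S h1 h2 =>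
      ((γ s).2.2 S h1 h2).trans_le (Nat.mul_le_mul_left _ (rk_Theta hd hdN _ S))⟩
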